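/- arXiv:1302.4135 — 4 statements merged into one kernel-verified Lean document; each statement's English description precedes it below -/
import Mathlib

section
/- Let C be a unital C*-algebra and let x ∈ C be an element with x² = 0. Then x lies in the norm-closure of the set of invertible elements of C. (Lemma 4.9, an observation of Rørdam.) -/
/-- Lemma 4.9 (Rørdam): in a unital C*-algebra, every element `x` with `x ^ 2 = 0`
lies in the norm-closure of the group of invertible elements. -/
theorem nilpotent_mem_closure_invertibles
    {C : Type*} [CStarAlgebra C] (x : C) (hx : x ^ 2 = 0) :
    x ∈ closure {y : C | IsUnit y} := by
  have hnil : IsNilpotent x := ⟨2, hx⟩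
  have hcont : Continuous (fun t : ℂ => x + algebraMap ℂ C t) := by fun_prop
  have ht : Filter.Tendsto (fun t : ℂ => x + algebraMap ℂ C t)
      (nhdsWithin 0 {0}ᶜ) (nhds x) := by
    have h := hcont.tendsto 0
    simp only [map_zero, add_zero] at h
    exact h.mono_left nhdsWithin_le_nhds
  refine mem_closure_of_tendsto ht ?_
  filter_upwards [self_mem_nhdsWithin] with t h0
  have hu : IsUnit (algebraMap ℂ C t) := (IsUnit.mk0 t h0).map (algebraMap ℂ C)
  have h := hnil.isUnit_add_left_of_commute hu (Algebra.commutes t x).symm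
  first
    | exact h
    | simpa [add_comm] using h
end

section
/- For every ε > 0 there exists δ > 0 such that the following holds: if C is a unital C*-algebra and p, q ∈ C are projections with ‖pq − p‖ < δ, then there exists a unitary u ∈ C such that u p u* ≤ q and ‖u − 1‖ < ε. (Lemma 4.8.) -/
theorem projclose_unitary {C : Type} [CStarAlgebra C] (p r : C) (η : ℝ)
    (hps : IsSelfAdjoint p) (hp : p * p = p) (hrs : IsSelfAdjoint r) (hr : r * r = r)
    (hη : ‖r - p‖ ≤ η) (hη' : η ≤ 3 / 4) :
    ∃ u : C, u ∈ unitary C ∧ u * p * star u = r ∧ ‖u - 1‖ ≤ 11 * η := by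
  have hη0 : 0 ≤ η := (norm_nonneg _).trans hη
  have hp2 : ∀ z, p * (p * z) = p * z := fun z => by rw [← mul_assoc, hp]
  have hr2 : ∀ z, r * (r * z) = r * z := fun z => by rw [← mul_assoc, hr]
  have hpn : ‖p‖ ≤ 1 := IsStarProjection.norm_le p ⟨hp, hps⟩
  have h1n : ‖(1 : C)‖ ≤ 1 := IsStarProjection.norm_le 1 ⟨one_mul 1, IsSelfAdjoint.one C⟩
  obtain ⟨c, hc⟩ : ∃ c, c = 1 - (r - p) * (r - p) := ⟨_, rfl⟩
  obtain ⟨x, hx⟩ : ∃ x, x = 1 - p - r + r * p + r * p := ⟨_, rfl⟩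
  have hsx : star x = 1 - p - r + p * r + p * r := by
    rw [hx]; simp [hps.star_eq, hrs.star_eq]
  have hxx : star x * x = c := by
    rw [hsx, hx, hc]
    simp only [mul_add, add_mul, mul_sub, sub_mul, mul_assoc, hp, hr, hp2, hr2, mul_one, one_mul]
    abel
  have hxx' : x * star x = c := by
    rw [hsx, hx, hc]
    simp only [mul_add, add_mul, mul_sub, sub_mul, mul_assoc, hp, hr, hp2, hr2, mul_one, one_mul]
    abel
  have hxp : x * p = r * x := by
    rw [hx]
    simp only [mul_add, add_mul, mul_sub, sub_mul, mul_assoc, hp, hr, hp2, hr2, mul_one, one_mul]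
    abel
  have hcp : Commute c p := by
    unfold Commute SemiconjBy
    rw [hc]
    simp only [mul_add, add_mul, mul_sub, sub_mul, mul_assoc, hp, hr, hp2, hr2, mul_one, one_mul]
    abel
  have hcx : Commute c x := by
    unfold Commute SemiconjBy
    nth_rw 1 [← hxx']
    rw [mul_assoc, hxx]
  have hcs : IsSelfAdjoint c := hxx ▸ IsSelfAdjoint.star_mul_self x
  have hc1 : ‖c - 1‖ ≤ η := by
    have : c - 1 = -((r - p) * (r - p)) := by rw [hc]; abel
    rw [this, norm_neg]
    refine (norm_mul_le _ _).trans ?_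
    nlinarith [norm_nonneg (r - p)]
  have hx1 : ‖x - 1‖ ≤ 3 * η := by
    have : x - 1 = (r - p) * (p + p - 1) := by
      rw [hx]
      simp only [mul_add, add_mul, mul_sub, sub_mul, mul_assoc, hp, mul_one]
      abel
    rw [this]
    refine (norm_mul_le _ _).trans ?_
    have : ‖p + p - 1‖ ≤ 3 := by
      refine (norm_sub_le _ _).trans ?_
      linarith [norm_add_le p p]
    nlinarith [norm_nonneg (r - p), norm_nonneg (p + p - 1)]
  have hspec : ∀ t ∈ spectrum ℝ c, |t - 1| ≤ η := by
    intro t ht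
    have h2 : t - 1 ∈ spectrum ℝ (c - 1) := by
      have := (spectrum.sub_singleton_eq c (1 : ℝ)).subset (Set.sub_mem_sub ht (Set.mem_singleton _))
      simpa using this
    have h3 := spectrum.norm_le_norm_mul_of_mem h2
    rw [Real.norm_eq_abs] at h3
    nlinarith [norm_nonneg (c - 1)]
  have hspec' : ∀ t ∈ spectrum ℝ c, 1 / 4 ≤ t := fun t ht => by
    have := abs_le.1 (hspec t ht); linarith
  have hcont : ContinuousOn (fun t : ℝ => (√t)⁻¹) (spectrum ℝ c) := by
    refine ContinuousOn.inv₀ Real.continuous_sqrt.continuousOn ?_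
    intro t ht
    have := hspec' t ht
    exact (Real.sqrt_pos.2 (by linarith)).ne'
  obtain ⟨h, hh⟩ : ∃ h, h = cfc (fun t : ℝ => (√t)⁻¹) c := ⟨_, rfl⟩
  have hhs : IsSelfAdjoint h := by rw [hh]; exact cfc_predicate _ c
  have hhc : h * h * c = 1 := by
    nth_rw 1 [← cfc_id ℝ c]
    rw [hh, ← cfc_mul _ _ c hcont hcont, ← cfc_mul (fun t : ℝ => (√t)⁻¹ * (√t)⁻¹) _ c (hcont.mul hcont) continuousOn_id,
      ← cfc_one ℝ c]
    refine cfc_congr ?_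
    intro t ht
    have h4 := hspec' t ht
    have h5 : 0 < √t := Real.sqrt_pos.2 (by linarith)
    have h6 : √t * √t = t := Real.mul_self_sqrt (by linarith)
    simp only [id, Pi.one_apply]
    field_simp
    nlinarith
  have hhp : Commute h p := by rw [hh]; exact hcp.cfc_real _
  have hhx : Commute h x := by rw [hh]; exact hcx.cfc_real _
  have hhc' : Commute h c := by rw [hh]; exact (Commute.refl c).cfc_real _
  have hh1 : ‖h - 1‖ ≤ 2 * η := by
    rw [hh, ← cfc_one ℝ c, ← cfc_sub _ 1 c hcont continuousOn_const]
    refine norm_cfc_le (by positivity) ?_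
    intro t ht
    have h4 := hspec' t ht
    have h5 : 1 / 2 ≤ √t := Real.le_sqrt_of_sq_le (by linarith)
    have h6 : √t * √t = t := Real.mul_self_sqrt (by linarith)
    have h7 : (√t)⁻¹ - 1 = (1 - t) * ((√t) * (1 + √t))⁻¹ := by
      field_simp
      nlinarith
    simp only [Pi.one_apply]
    rw [h7, norm_mul, Real.norm_eq_abs, abs_sub_comm, mul_comm]
    refine mul_le_mul ?_ (hspec t ht) (abs_nonneg _) (by norm_num)
    rw [Real.norm_of_nonneg (by positivity)]
    refine inv_le_of_inv_le₀ (by norm_num) ?_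
    nlinarith
  have key : x * h * (h * star x) = 1 := by
    rw [← hhx.eq, mul_assoc, ← mul_assoc x, ← hhx.eq, mul_assoc, hxx', ← mul_assoc, hhc]
  refine ⟨x * h, ?_, ?_, ?_⟩
  · rw [Unitary.mem_iff, star_mul, hhs.star_eq]
    refine ⟨?_, key⟩
    rw [mul_assoc, ← mul_assoc (star x), hxx, ← hhc'.eq, ← mul_assoc, hhc]
  · rw [star_mul, hhs.star_eq, mul_assoc x, hhp.eq, ← mul_assoc x, hxp, mul_assoc r, mul_assoc r,
      key, mul_one]
  · have : x * h - 1 = (x - 1) * h + (h - 1) := by simp [sub_mul]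
    have hhn : ‖h‖ ≤ 3 := by
      have : ‖h‖ ≤ ‖h - 1‖ + ‖(1 : C)‖ := by simpa using norm_add_le (h - 1) 1
      linarith
    rw [this]
    refine (norm_add_le _ _).trans ?_
    have := norm_mul_le (x - 1) h
    nlinarith [norm_nonneg (x - 1), norm_nonneg h]

theorem projclose_sub {C : Type} [CStarAlgebra C] (p q : C) (δ : ℝ)
    (hps : IsSelfAdjoint p) (hp : p * p = p) (hqs : IsSelfAdjoint q) (hq : q * q = q)
    (hδ : ‖p * q - p‖ ≤ δ) (hδ' : δ ≤ 1 / 2) :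
    ∃ r : C, IsSelfAdjoint r ∧ r * r = r ∧ q * r = r ∧ ‖r - p‖ ≤ 3 * δ := by
  have hp2 : ∀ z, p * (p * z) = p * z := fun z => by rw [← mul_assoc, hp]
  have hq2 : ∀ z, q * (q * z) = q * z := fun z => by rw [← mul_assoc, hq]
  have hpn : ‖p‖ ≤ 1 := IsStarProjection.norm_le p ⟨hp, hps⟩
  have hqn : ‖q‖ ≤ 1 := IsStarProjection.norm_le q ⟨hq, hqs⟩
  have h1n : ‖(1 : C)‖ ≤ 1 := IsStarProjection.norm_le 1 ⟨one_mul 1, IsSelfAdjoint.one C⟩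
  have hpn' : ‖1 - p‖ ≤ 1 :=
    IsStarProjection.norm_le _ (IsStarProjection.one_sub ⟨hp, hps⟩)
  obtain ⟨d, hd⟩ : ∃ d, d = p - p * q * p := ⟨_, rfl⟩
  have hdn : ‖d‖ ≤ δ := by
    have : d = -((p * q - p) * p) := by rw [hd, sub_mul, hp]; abel
    rw [this, norm_neg]
    refine (norm_mul_le _ _).trans ?_
    nlinarith [norm_nonneg (p * q - p)]
  have hds : IsSelfAdjoint d := by
    unfold IsSelfAdjoint; rw [hd]; simp [hps.star_eq, hqs.star_eq, mul_assoc]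
  have hdp : Commute d p := by
    unfold Commute SemiconjBy
    rw [hd]; simp only [mul_sub, sub_mul, mul_assoc, hp, hp2]
  have hap : (1 - d) * p = p * q * p := by
    rw [hd]; simp only [mul_sub, sub_mul, mul_assoc, hp, hp2, one_mul]; abel
  let v : Cˣ := Units.oneSub d (by linarith)
  have hv : (v : C) = 1 - d := rfl
  obtain ⟨b, hb⟩ : ∃ b : C, b = ↑v⁻¹ := ⟨_, rfl⟩
  have hba : b * (1 - d) = 1 := by rw [hb, ← hv]; exact v.inv_mul
  have hab : (1 - d) * b = 1 := by rw [hb, ← hv]; exact v.mul_inv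
  have hbs : star b = b := by
    have h1 : star b * (1 - d) = 1 := by
      have := congrArg star hab
      simpa [hds.star_eq] using this
    calc star b = star b * ((1 - d) * b) := by rw [hab, mul_one]
      _ = b := by rw [← mul_assoc, h1, one_mul]
  have hbp : b * p = p * b := by
    have hvp : Commute (v : C) p := by rw [hv]; exact (Commute.one_left p).sub_left hdp
    rw [hb]; exact hvp.units_inv_left.eq
  have hbpqp : b * (p * (q * p)) = p := by
    rw [← mul_assoc p, ← hap, ← mul_assoc, hba, one_mul]
  have hbn : ‖b‖ ≤ 2 := by
    have h1 : b = 1 + b * d := by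
      have := hba; rw [mul_sub, mul_one] at this; rw [← this]; abel
    have h2 : ‖b‖ ≤ ‖(1 : C)‖ + ‖b * d‖ := by
      calc ‖b‖ = ‖1 + b * d‖ := by rw [← h1]
        _ ≤ _ := norm_add_le _ _
    have := norm_mul_le b d
    nlinarith [norm_nonneg b, norm_nonneg d]
  have hrp : q * b * p * q * p = q * p := by
    simp only [mul_assoc, hbpqp]
  refine ⟨q * b * p * q, ?_, ?_, ?_, ?_⟩
  · unfold IsSelfAdjoint
    simp only [star_mul, hps.star_eq, hqs.star_eq, hbs, mul_assoc]
    rw [← mul_assoc p b, ← hbp, mul_assoc]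
  · have : q * b * p * q * (q * b * p * q) = q * b * p * q * p * b * q := by
      simp only [mul_assoc, hq2]
      rw [← mul_assoc b p q, hbp, mul_assoc]
    rw [this, hrp, mul_assoc q p, ← hbp, mul_assoc, mul_assoc, mul_assoc, mul_assoc]
  · simp only [mul_assoc, hq2]
  · have h1 : q * b * p * q - p = q * b * ((p * q - p) * (1 - p)) + (q * p - p) := by
      have : (p * q - p) * (1 - p) = p * q - p * q * p := by
        simp only [mul_sub, sub_mul, hp, mul_one]; abel
      rw [this, mul_sub]
      simp only [mul_assoc, hbpqp]; abel
    have h2 : ‖q * p - p‖ ≤ δ := by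
      rw [← norm_star]; simpa [hps.star_eq, hqs.star_eq] using hδ
    have h3 : ‖(p * q - p) * (1 - p)‖ ≤ δ := by
      refine (norm_mul_le _ _).trans ?_
      nlinarith [norm_nonneg (p * q - p)]
    have h4 : ‖q * b‖ ≤ 2 := by
      refine (norm_mul_le _ _).trans ?_
      nlinarith [norm_nonneg q, norm_nonneg b]
    rw [h1]
    refine (norm_add_le _ _).trans ?_
    have := norm_mul_le (q * b) ((p * q - p) * (1 - p))
    nlinarith [norm_nonneg (q * b), norm_nonneg ((p * q - p) * (1 - p))]

/-- Lemma 4.8: for every `ε > 0` there is `δ > 0` such that in any unital C*-algebra,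
whenever `p, q` are projections with `‖p * q - p‖ < δ`, there exists a unitary `u`
with `u * p * u* ≤ q` and `‖u - 1‖ < ε`. -/
theorem exists_unitary_conj_le_of_proj_close :
    ∀ ε > (0 : ℝ), ∃ δ > (0 : ℝ),
      ∀ (C : Type) [CStarAlgebra C] [PartialOrder C] [StarOrderedRing C],
        ∀ p q : C,
          IsSelfAdjoint p → p * p = p →
          IsSelfAdjoint q → q * q = q →
          ‖p * q - p‖ < δ →
          ∃ u : C, u ∈ unitary C ∧ u * p * star u ≤ q ∧ ‖u - 1‖ < ε := by
  intro ε hε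
  refine ⟨min (1 / 4) (ε / 40), by positivity, ?_⟩
  intro C _ _ _ p q hps hp hqs hq h
  have hm1 := min_le_left (1 / 4) (ε / 40)
  have hm2 := min_le_right (1 / 4) (ε / 40)
  obtain ⟨r, hrs, hr, hqr, hrn⟩ := projclose_sub p q _ hps hp hqs hq h.le (by linarith)
  obtain ⟨u, hu, hup, hun⟩ := projclose_unitary p r _ hps hp hrs hr hrn (by linarith)
  refine ⟨u, hu, ?_, by linarith⟩
  have hrq : r * q = r := by
    have := congrArg star hqr
    simpa [hrs.star_eq, hqs.star_eq] using this
  rw [hup, ← sub_nonneg]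
  have : q - r = star (q - r) * (q - r) := by
    rw [star_sub, hrs.star_eq, hqs.star_eq]
    simp only [mul_sub, sub_mul, hq, hr, hqr, hrq]; abel
  rw [this]
  exact star_mul_self_nonneg _
end

section
/- Let D be a C*-algebra and let p, q, r, s ∈ D be projections with q ≤ p, r ≤ p, s ≤ p, qs = sq = 0 and rs = sr = 0. Suppose there exist partial isometries v, w ∈ D with v*v = q, vv* ≤ s and w*w = s, ww* ≤ r (witnessing q ≾ s ≾ r). Then for every unitary u of the corner qDq there exists a norm-continuous path t ↦ u(t), t ∈ [0,1], of unitaries of the corner pDp such that u(0) = u + (p − q) and u(1) = v₀ + (p − r) for some unitary v₀ of the corner rDr. (Lemma 4.14, in the Murray–von Neumann subequivalence form established by its proof.) -/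
/-- A partial isometry is fixed by its source projection. -/
lemma partialIsometry_mul_source {D : Type*} [NonUnitalCStarAlgebra D] (q y : D)
    (hq : IsSelfAdjoint q) (hq2 : q * q = q) (hy : star y * y = q) : y * q = y := by
  have h : star (y * q - y) * (y * q - y) = 0 := by
    have e : star (y * q - y) * (y * q - y)
        = q * (star y * y) * q - q * (star y * y) - (star y * y) * q + star y * y := by
      rw [star_sub, star_mul, hq.star_eq]
      noncomm_ring
    rw [e, hy, hq2, hq2]
    abel
  exact sub_eq_zero.mp ((CStarRing.star_mul_self_eq_zero_iff _).mp h)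

/-- A projection dominating the range projection fixes the partial isometry. -/
lemma mul_partialIsometry_of_range_le {D : Type*} [NonUnitalCStarAlgebra D] [PartialOrder D]
    [StarOrderedRing D] (q s y : D)
    (hq : IsSelfAdjoint q) (hq2 : q * q = q) (hs : IsSelfAdjoint s) (hs2 : s * s = s)
    (hy : star y * y = q) (hys : y * star y ≤ s) : s * y = y := by
  have h1 := partialIsometry_mul_source q y hq hq2 hy
  have hP : IsStarProjection (y * star y) := by
    refine ⟨?_, IsSelfAdjoint.mul_star_self y⟩
    show y * star y * (y * star y) = y * star y
    rw [← mul_assoc, mul_assoc y, hy, h1]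
  have h2 := (IsStarProjection.le_iff_mul_eq_right hP ⟨hs2, hs⟩).mp hys
  calc s * y = s * (y * star y) * y := by rw [mul_assoc, mul_assoc, hy, h1]
    _ = y := by rw [h2, mul_assoc, hy, h1]

/-- Transporting a unitary of `qDq` along a partial isometry and extending by the identity. -/
lemma transported_unitary {D : Type*} [NonUnitalCStarAlgebra D] (p q y u : D)
    (hp : IsSelfAdjoint p) (hp2 : p * p = p)
    (hq : IsSelfAdjoint q) (hq2 : q * q = q)
    (hy : star y * y = q) (hpy : p * y = y)
    (hu : u = q * u * q) (hu1 : star u * u = q) (hu2 : u * star u = q) :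
    (p - y * star y + y * u * star y = p * (p - y * star y + y * u * star y) * p) ∧
      star (p - y * star y + y * u * star y) * (p - y * star y + y * u * star y) = p ∧
      (p - y * star y + y * u * star y) * star (p - y * star y + y * u * star y) = p := by
  have hyq := partialIsometry_mul_source q y hq hq2 hy
  have hyp : star y * p = star y := by
    have := congrArg star hpy
    rwa [star_mul, hp.star_eq] at this
  have hqu : q * u = u := by
    rw [hu, ← mul_assoc, ← mul_assoc, hq2]
  have hqu' : q * star u = star u := by
    have : u * q = u := by rw [hu, mul_assoc, hq2]
    have := congrArg star this
    rwa [star_mul, hq.star_eq] at this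
  have hqy : q * star y = star y := by
    have := congrArg star hyq
    rwa [star_mul, hq.star_eq] at this
  have hpy' (z : D) : p * (y * z) = y * z := by rw [← mul_assoc, hpy]
  have hy' (z : D) : star y * (y * z) = q * z := by rw [← mul_assoc, hy]
  have hqu1 (z : D) : q * (u * z) = u * z := by rw [← mul_assoc, hqu]
  have hqu2 (z : D) : q * (star u * z) = star u * z := by rw [← mul_assoc, hqu']
  have hu1' (z : D) : star u * (u * z) = q * z := by rw [← mul_assoc, hu1]
  have hu2' (z : D) : u * (star u * z) = q * z := by rw [← mul_assoc, hu2]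
  refine ⟨?_, ?_, ?_⟩ <;>
  · simp only [star_add, star_sub, star_mul, star_star, hp.star_eq, mul_add, add_mul, mul_sub,
      sub_mul, mul_assoc, hpy', hy', hqu1, hqu2, hu1', hu2', hqy, hyp, hp2]
    try abel

/-- Lemma 4.14 (Murray–von Neumann subequivalence form): if `p, q, r, s` are projections
in a C*-algebra `D` with `q, r, s ≤ p`, `s` orthogonal to `q` and to `r`, and
`q ≾ s ≾ r` (witnessed by partial isometries `v, w`), then for every unitary `u` of the
corner `qDq` there is a norm-continuous path of unitaries of the corner `pDp` from
`u + (p - q)` to `v₀ + (p - r)` for some unitary `v₀` of the corner `rDr`. -/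
theorem exists_path_of_corner_unitary_subequiv
    {D : Type*} [NonUnitalCStarAlgebra D] [PartialOrder D] [StarOrderedRing D]
    (p q r s : D)
    (hp : IsSelfAdjoint p) (hp2 : p * p = p)
    (hq : IsSelfAdjoint q) (hq2 : q * q = q)
    (hr : IsSelfAdjoint r) (hr2 : r * r = r)
    (hs : IsSelfAdjoint s) (hs2 : s * s = s)
    (hqp : q ≤ p) (hrp : r ≤ p) (hsp : s ≤ p)
    (hqs : q * s = 0) (hsq : s * q = 0)
    (hrs : r * s = 0) (hsr : s * r = 0)
    (v : D) (hv : star v * v = q) (hv' : v * star v ≤ s)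
    (w : D) (hw : star w * w = s) (hw' : w * star w ≤ r)
    (u : D) (hu : u = q * u * q) (hu1 : star u * u = q) (hu2 : u * star u = q) :
    ∃ U : ℝ → D,
      ContinuousOn U (Set.Icc (0 : ℝ) 1) ∧
      (∀ t ∈ Set.Icc (0 : ℝ) 1,
        U t = p * U t * p ∧ star (U t) * U t = p ∧ U t * star (U t) = p) ∧
      U 0 = u + (p - q) ∧
      ∃ v₀ : D, (v₀ = r * v₀ * r ∧ star v₀ * v₀ = r ∧ v₀ * star v₀ = r) ∧
        U 1 = v₀ + (p - r) := by
  have hpq : p * q = q := (IsStarProjection.le_iff_mul_eq_right ⟨hq2, hq⟩ ⟨hp2, hp⟩).mp hqp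
  have hpr : p * r = r := (IsStarProjection.le_iff_mul_eq_right ⟨hr2, hr⟩ ⟨hp2, hp⟩).mp hrp
  have hps : p * s = s := (IsStarProjection.le_iff_mul_eq_right ⟨hs2, hs⟩ ⟨hp2, hp⟩).mp hsp
  have hvq := partialIsometry_mul_source q v hq hq2 hv
  have hsv := mul_partialIsometry_of_range_le q s v hq hq2 hs hs2 hv hv'
  have hrw := mul_partialIsometry_of_range_le s r w hs hs2 hr hr2 hw hw'
  have hpv : p * v = v := by rw [← hsv, ← mul_assoc, hps]
  have hpw : p * w = w := by rw [← hrw, ← mul_assoc, hpr]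
  have hqv : q * v = 0 := by rw [← hsv, ← mul_assoc, hqs, zero_mul]
  have hvq0 : star v * q = 0 := by
    have := congrArg star hqv
    rwa [star_mul, hq.star_eq, star_zero] at this
  have hvs : star v * s = star v := by
    have := congrArg star hsv
    rwa [star_mul, hs.star_eq] at this
  obtain ⟨x, hx⟩ : ∃ x, x = w * v := ⟨_, rfl⟩
  have hrx : r * x = x := by rw [hx, ← mul_assoc, hrw]
  have hpx : p * x = x := by rw [hx, ← mul_assoc, hpw]
  have hxx : star x * x = q := by
    rw [hx, star_mul, mul_assoc, ← mul_assoc (star w), hw, hsv, hv]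
  have hvx : star v * x = 0 := by
    rw [← hrx, ← hvs, mul_assoc, ← mul_assoc s, hsr, zero_mul, mul_zero]
  have hxv : star x * v = 0 := by
    have := congrArg star hvx
    rwa [star_mul, star_star, star_zero] at this
  -- the path of partial isometries
  let a : ℝ → ℝ := fun t => max (Real.cos (Real.pi * t)) 0
  let b : ℝ → ℝ := fun t => Real.sin (Real.pi * t)
  let c : ℝ → ℝ := fun t => max (-Real.cos (Real.pi * t)) 0
  let y : ℝ → D := fun t => a t • q + b t • v + c t • x
  have hac : ∀ t, a t * c t = 0 := by
    intro t
    rcases le_total (Real.cos (Real.pi * t)) 0 with h | h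
    · simp [a, max_eq_right h]
    · simp [c, h]
  have hsum : ∀ t, a t * a t + b t * b t + c t * c t = 1 := by
    intro t
    have := Real.sin_sq_add_cos_sq (Real.pi * t)
    rcases le_total (Real.cos (Real.pi * t)) 0 with h | h
    · have h1 : a t = 0 := max_eq_right h
      have h2 : c t = -Real.cos (Real.pi * t) := max_eq_left (by linarith)
      rw [h1, h2]; simp only [b]; nlinarith
    · have h1 : a t = Real.cos (Real.pi * t) := max_eq_left h
      have h2 : c t = 0 := max_eq_right (by linarith)
      rw [h1, h2]; simp only [b]; nlinarith
  have hyc : Continuous y := by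
    simp only [y, a, b, c]
    fun_prop
  have hyy : ∀ t, star (y t) * y t = q := by
    intro t
    have e : star (y t) * y t = (a t * a t + b t * b t + c t * c t) • q
        + (a t * c t) • (q * x + star x * q) := by
      simp only [y, star_add, star_smul, star_trivial, hq.star_eq, mul_add, add_mul,
        smul_mul_assoc, mul_smul_comm, hq2, hv, hxx, hvx, hxv, hqv, hvq0, smul_zero, smul_smul,
        add_smul, smul_add, mul_comm (c t) (a t)]
      abel
    rw [e, hac, hsum, zero_smul, one_smul, add_zero]
  have hpy : ∀ t, p * y t = y t := by
    intro t
    simp only [y, mul_add, mul_smul_comm, hpq, hpv, hpx]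
  refine ⟨fun t => p - y t * star (y t) + y t * u * star (y t), ?_, ?_, ?_, ?_⟩
  · exact Continuous.continuousOn (by fun_prop)
  · intro t _
    exact transported_unitary p q (y t) u hp hp2 hq hq2 (hyy t) (hpy t) hu hu1 hu2
  · have h0 : y 0 = q := by simp [y, a, b, c]
    simp only [h0, hq.star_eq, hq2]
    rw [← hu]
    abel
  · have h1 : y 1 = x := by simp [y, a, b, c]
    refine ⟨r - x * star x + x * u * star x,
      transported_unitary r q x u hr hr2 hq hq2 hxx hrx hu hu1 hu2, ?_⟩
    simp only [h1]
    abel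
end

section
/- Let D be a unital C*-algebra, let e₁ ≤ e₂ ≤ e₃ ≤ 1 be projections in D, and let w ∈ D be a unitary such that we₁w* ≤ e₂ and e₂ ≤ we₃w*. Suppose there exist elements v₁, v₂, v₃, v₄ ∈ D with v₁*v₁ = e₁, v₁v₁* = we₁w*; v₂*v₂ = e₂ − e₁, v₂v₂* = e₂ − we₁w*; v₃*v₃ = e₃ − e₂, v₃v₃* = we₃w* − e₂; and v₄*v₄ = 1 − e₃, v₄v₄* = 1 − we₃w*. Then there exist unitaries z, y ∈ D such that w = zy, z commutes with e₂, and y commutes with e₁. (The Elliott-type block factorization established in the proof of Lemma 4.12.) -/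
theorem block_aux_right {D : Type*} [CStarAlgebra D] (v p : D)
    (h : star v * v = p) (hp : p * p = p) : v * p = v := by
  have hs : star p = p := by rw [← h]; simp
  have h0 : star (v - v * p) * (v - v * p) = 0 := by
    have e : star (v - v * p) * (v - v * p)
        = star v * v - star v * v * p - star p * (star v * v) + star p * (star v * v) * p := by
      rw [star_sub, star_mul]; noncomm_ring
    rw [e, h, hs, hp, hp]; simp
  exact (sub_eq_zero.mp (CStarRing.star_mul_self_eq_zero_iff _ |>.mp h0)).symm

theorem block_aux_left {D : Type*} [CStarAlgebra D] (v p : D)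
    (h : v * star v = p) (hp : p * p = p) : p * v = v := by
  have hs : star p = p := by rw [← h]; simp
  have := block_aux_right (star v) p (by simpa using h) hp
  have h2 := congrArg star this
  simpa [hs] using h2

theorem block_aux_le {D : Type*} [CStarAlgebra D] [PartialOrder D] [StarOrderedRing D]
    (p q : D) (hp : IsSelfAdjoint p) (hpp : p * p = p) (hq : IsSelfAdjoint q) (hqq : q * q = q)
    (h : p ≤ q) : p * q = p ∧ q * p = p := by
  have h1 : star (1 - q) * p * (1 - q) ≤ star (1 - q) * q * (1 - q) :=
    star_left_conjugate_le_conjugate h _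
  have h2 : star (1 - q) * q * (1 - q) = 0 := by
    have e : star (1 - q) * q * (1 - q) = q - q * q - q * q + q * q * q := by
      rw [star_sub, hq.star_eq, star_one]; noncomm_ring
    rw [e, hqq, hqq]; simp
  have h3 : star (1 - q) * p * (1 - q) = star (p * (1 - q)) * (p * (1 - q)) := by
    rw [star_mul, hp.star_eq]
    calc _ = star (1 - q) * (p * p) * (1 - q) := by rw [hpp]
      _ = _ := by noncomm_ring
  have h4 : star (p * (1 - q)) * (p * (1 - q)) = 0 :=
    le_antisymm (h3 ▸ h2 ▸ h1) (star_mul_self_nonneg _)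
  have h5 := (CStarRing.star_mul_self_eq_zero_iff _).mp h4
  have h6 : p * q = p := by
    rw [mul_sub, mul_one] at h5
    exact (sub_eq_zero.mp h5).symm
  refine ⟨h6, ?_⟩
  have h7 := congrArg star h6
  simpa [hp.star_eq, hq.star_eq] using h7

/-- The Elliott-type block factorization from the proof of Lemma 4.12: given projections
`e₁ ≤ e₂ ≤ e₃ ≤ 1` in a unital C*-algebra `D` and a unitary `w` with `w e₁ w* ≤ e₂` and
`e₂ ≤ w e₃ w*`, together with partial isometries implementing the Murray–von Neumann
equivalences `e₁ ∼ w e₁ w*`, `e₂ - e₁ ∼ e₂ - w e₁ w*`, `e₃ - e₂ ∼ w e₃ w* - e₂` and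
`1 - e₃ ∼ 1 - w e₃ w*`, one can factor `w = z y` with `z, y` unitaries, `z` commuting
with `e₂` and `y` commuting with `e₁`. -/
theorem exists_block_factorization
    {D : Type*} [CStarAlgebra D] [PartialOrder D] [StarOrderedRing D]
    (e₁ e₂ e₃ : D)
    (he₁ : IsSelfAdjoint e₁) (he₁2 : e₁ * e₁ = e₁)
    (he₂ : IsSelfAdjoint e₂) (he₂2 : e₂ * e₂ = e₂)
    (he₃ : IsSelfAdjoint e₃) (he₃2 : e₃ * e₃ = e₃)
    (h12 : e₁ ≤ e₂) (h23 : e₂ ≤ e₃) (h31 : e₃ ≤ 1)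
    (w : D) (hw : w ∈ unitary D)
    (hw1 : w * e₁ * star w ≤ e₂) (hw3 : e₂ ≤ w * e₃ * star w)
    (v₁ : D) (hv₁ : star v₁ * v₁ = e₁) (hv₁' : v₁ * star v₁ = w * e₁ * star w)
    (v₂ : D) (hv₂ : star v₂ * v₂ = e₂ - e₁) (hv₂' : v₂ * star v₂ = e₂ - w * e₁ * star w)
    (v₃ : D) (hv₃ : star v₃ * v₃ = e₃ - e₂) (hv₃' : v₃ * star v₃ = w * e₃ * star w - e₂)
    (v₄ : D) (hv₄ : star v₄ * v₄ = 1 - e₃) (hv₄' : v₄ * star v₄ = 1 - w * e₃ * star w) :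
    ∃ z y : D, z ∈ unitary D ∧ y ∈ unitary D ∧
      w = z * y ∧ z * e₂ = e₂ * z ∧ y * e₁ = e₁ * y := by
  obtain ⟨hwl, hwr⟩ := Unitary.mem_iff.mp hw
  obtain ⟨k12, k21⟩ := block_aux_le e₁ e₂ he₁ he₁2 he₂ he₂2 h12
  obtain ⟨a, ha⟩ : ∃ a, a = w * e₁ := ⟨_, rfl⟩
  obtain ⟨f, hf⟩ : ∃ f, f = w * e₁ * star w := ⟨_, rfl⟩
  rw [← hf] at hw1 hv₂'
  have ha1 : star a * a = e₁ := by
    rw [ha, star_mul, he₁.star_eq]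
    calc _ = e₁ * (star w * w) * e₁ := by noncomm_ring
      _ = e₁ := by rw [hwl, mul_one, he₁2]
  have ha2 : a * star a = f := by
    rw [ha, hf, star_mul, he₁.star_eq]
    calc _ = w * (e₁ * e₁) * star w := by noncomm_ring
      _ = _ := by rw [he₁2]
  have hae : a * e₁ = a := by rw [ha, mul_assoc, he₁2]
  have hfs : IsSelfAdjoint f := by rw [← ha2]; exact IsSelfAdjoint.mul_star_self a
  have hff : f * f = f := by
    calc f * f = a * (star a * a) * star a := by rw [← ha2]; noncomm_ring
      _ = f := by rw [ha1, hae, ha2]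
  obtain ⟨kf2, k2f⟩ := block_aux_le f e₂ hfs hff he₂ he₂2 hw1
  have hfa : f * a = a := block_aux_left a f ha2 hff
  have hvr := block_aux_right v₂ _ hv₂ (by
    rw [sub_mul, mul_sub, mul_sub, he₂2, he₁2, k12, k21]; simp)
  have hvl := block_aux_left v₂ _ hv₂' (by
    rw [sub_mul, mul_sub, mul_sub, he₂2, hff, kf2, k2f]; simp)
  have a2 : a * e₂ = a := by rw [← hae, mul_assoc, k12]
  have l2a : e₂ * a = a := by rw [← hfa, ← mul_assoc, k2f]
  have v2 : v₂ * e₂ = v₂ := by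
    conv_lhs => rw [← hvr]
    rw [mul_assoc, sub_mul, he₂2, k12, hvr]
  have l2v : e₂ * v₂ = v₂ := by
    conv_lhs => rw [← hvl]
    rw [← mul_assoc, mul_sub, he₂2, k2f, hvl]
  have v1 : v₂ * e₁ = 0 := by
    rw [mul_sub, v2] at hvr
    simpa using hvr
  have lfv : f * v₂ = 0 := by
    rw [sub_mul, l2v] at hvl
    simpa using hvl
  have av : star a * v₂ = 0 := by
    have : star a * f = star a := by
      have := congrArg star hfa
      simpa [hfs.star_eq] using this
    rw [← this, mul_assoc, lfv, mul_zero]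
  have va : star v₂ * a = 0 := by simpa using congrArg star av
  have vsa : v₂ * star a = 0 := by
    have : e₁ * star a = star a := by simpa [he₁.star_eq] using congrArg star hae
    rw [← this, ← mul_assoc, v1, zero_mul]
  have asv : a * star v₂ = 0 := by simpa using congrArg star vsa
  have sa2 : star a * e₂ = star a := by simpa [he₂.star_eq] using congrArg star l2a
  have sv2 : star v₂ * e₂ = star v₂ := by simpa [he₂.star_eq] using congrArg star l2v
  have l2sa : e₂ * star a = star a := by simpa [he₂.star_eq] using congrArg star a2
  have l2sv : e₂ * star v₂ = star v₂ := by simpa [he₂.star_eq] using congrArg star v2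
  obtain ⟨z, hz⟩ : ∃ z, z = a + v₂ + (1 - e₂) := ⟨_, rfl⟩
  have hzs : star z = star a + star v₂ + (1 - e₂) := by
    rw [hz]; simp [he₂.star_eq]
  have hz1 : star z * z = 1 := by
    rw [hzs, hz]
    simp only [add_mul, mul_add, sub_mul, mul_sub, mul_one, one_mul, ha1, hv₂, av, va, sa2, sv2,
      l2a, l2v, he₂2]
    abel
  have hz2 : z * star z = 1 := by
    rw [hzs, hz]
    simp only [add_mul, mul_add, sub_mul, mul_sub, mul_one, one_mul, ha2, hv₂', asv, vsa, a2, v2,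
      l2sa, l2sv, he₂2]
    abel
  have hzu : z ∈ unitary D := Unitary.mem_iff.mpr ⟨hz1, hz2⟩
  have hze : z * e₁ = w * e₁ := by
    rw [hz, add_mul, add_mul, sub_mul, hae, v1, k21, one_mul, ha]; simp
  refine ⟨z, star z * w, hzu, mul_mem (Unitary.star_mem hzu) hw, ?_, ?_, ?_⟩
  · rw [← mul_assoc, hz2, one_mul]
  · rw [hz]
    simp only [add_mul, mul_add, sub_mul, mul_sub, mul_one, one_mul, a2, v2, l2a, l2v, he₂2]
  · have h1 : star z * w * e₁ = e₁ := by
      rw [mul_assoc, ← hze, ← mul_assoc, hz1, one_mul]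
    have h2 : e₁ * star z = e₁ * star w := by
      simpa [he₁.star_eq] using congrArg star hze
    rw [h1, ← mul_assoc, h2, mul_assoc, hwl, mul_one]
end
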